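/- Let N ≥ 1 and n ≥ N be integers and β ∈ ℂ with |β| < 1. Define ẑ : ℤ → ℂ by ẑ(n+1−N) = −conj(β)/(1−|β|²)² · (1 − (1 − N/(n+1))·|β|²), ẑ(n+1−N+jN) = (1 + N(j−1)/(n+1))·β^(j−1) for integers j ≥ 1, and ẑ(k) = 0 for all other k ∈ ℤ (in particular ẑ(n+1−N+jN) = 0 for j ≤ −1). Then for every k ∈ ℤ the series Σ_{l∈ℤ} û(k−l)·ẑ(l) converges absolutely and k·(|k|·ẑ(k) − Σ_{l∈ℤ} û(k−l)·ẑ(l)) = (n+1−N)·(n+1+N(1−α(β)))·ẑ(k); that is, ẑ is an eigenvector of the linearized Benjamin–Ono operator BA with eigenvalue ω_{N,n} = (n+1−N)(n+1+N(1−α(β))). -/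

import Mathlib

open Complex

/-- Fourier coefficients of the `N`-hump stationary solution of Benjamin–Ono. -/
noncomputable def uhat (N : ℕ) (β : ℂ) (k : ℤ) : ℂ :=
  if k = 0 then (N : ℂ) * (((1 - 3 * ‖β‖ ^ 2) / (1 - ‖β‖ ^ 2) : ℝ) : ℂ)
  else if (N : ℤ) ∣ k then
    if 0 < k then 2 * (N : ℂ) * β ^ ((k / (N : ℤ)).toNat)
    else 2 * (N : ℂ) * (starRingEnd ℂ β) ^ ((|k| / (N : ℤ)).toNat)
  else 0

/-- The eigenvector `ẑ_{N,n}` for `n ≥ N`: supported on `k = n+1-N+jN`, `j ≥ 0`. -/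
noncomputable def zhat (N n : ℕ) (β : ℂ) (k : ℤ) : ℂ :=
  if (N : ℤ) ∣ (k - ((n : ℤ) + 1 - (N : ℤ))) then
    let j : ℤ := (k - ((n : ℤ) + 1 - (N : ℤ))) / (N : ℤ)
    if j = 0 then
      -(starRingEnd ℂ β) / (1 - ((‖β‖ : ℂ)) ^ 2) ^ 2 *
        (1 - (1 - (N : ℂ) / ((n : ℂ) + 1)) * ((‖β‖ : ℂ)) ^ 2)
    else if 1 ≤ j then
      (1 + (N : ℂ) * ((j - 1 : ℤ) : ℂ) / ((n : ℂ) + 1)) * β ^ ((j - 1).toNat)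
    else 0
  else 0

theorem bo_geom (r a b : ℂ) (hr : ‖r‖ < 1) :
    HasSum (fun i : ℕ => (a + b * (i : ℂ)) * r ^ i) (a / (1 - r) + b * (r / (1 - r) ^ 2)) := by
  have h1 := (hasSum_geometric_of_norm_lt_one hr).mul_left a
  have h2 := (hasSum_coe_mul_geometric_of_norm_lt_one hr).mul_left b
  have h := h1.add h2
  rw [div_eq_mul_inv a]
  refine h.congr_fun ?_ |> id
  intro i
  ring

theorem bo_uhat_zero (N : ℕ) (β : ℂ) : uhat N β 0 =
    (N : ℂ) * (((1 - 3 * ‖β‖ ^ 2) / (1 - ‖β‖ ^ 2) : ℝ) : ℂ) := by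
  simp [uhat]

theorem bo_uhat_pos (N : ℕ) (hN : 1 ≤ N) (β : ℂ) (x : ℤ) (q : ℕ)
    (hx : x = (N : ℤ) * ((q : ℤ) + 1)) : uhat N β x = 2 * (N : ℂ) * β ^ (q + 1) := by
  have hN' : (0 : ℤ) < N := by exact_mod_cast hN
  have hpos : 0 < x := by rw [hx]; positivity
  have hd : (N : ℤ) ∣ x := ⟨_, hx⟩
  have hq : (x / (N : ℤ)).toNat = q + 1 := by
    rw [hx, Int.mul_ediv_cancel_left _ hN'.ne']; omega
  rw [uhat, if_neg hpos.ne', if_pos hd, if_pos hpos, hq]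

theorem bo_uhat_neg (N : ℕ) (hN : 1 ≤ N) (β : ℂ) (x : ℤ) (q : ℕ)
    (hx : x = -((N : ℤ) * ((q : ℤ) + 1))) :
    uhat N β x = 2 * (N : ℂ) * (starRingEnd ℂ β) ^ (q + 1) := by
  have hN' : (0 : ℤ) < N := by exact_mod_cast hN
  have hpos : x < 0 := by rw [hx, neg_lt_zero]; positivity
  have hd : (N : ℤ) ∣ x := ⟨-((q : ℤ) + 1), by rw [hx]; ring⟩
  have hq : (|x| / (N : ℤ)).toNat = q + 1 := by
    rw [abs_of_neg hpos, hx, neg_neg, Int.mul_ediv_cancel_left _ hN'.ne']; omega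
  rw [uhat, if_neg hpos.ne, if_pos hd, if_neg hpos.le.not_gt, hq]

theorem bo_uhat_not (N : ℕ) (β : ℂ) (x : ℤ) (hx : ¬ (N : ℤ) ∣ x) : uhat N β x = 0 := by
  have h0 : x ≠ 0 := by rintro rfl; exact hx (dvd_zero _)
  rw [uhat, if_neg h0, if_neg hx]

theorem bo_zhat_zero (N n : ℕ) (β : ℂ) (x : ℤ) (hx : x = (n : ℤ) + 1 - N) :
    zhat N n β x = -(starRingEnd ℂ β) / (1 - ((‖β‖ : ℂ)) ^ 2) ^ 2 *
        (1 - (1 - (N : ℂ) / ((n : ℂ) + 1)) * ((‖β‖ : ℂ)) ^ 2) := by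
  subst hx
  simp [zhat]

theorem bo_zhat_succ (N n : ℕ) (hN : 1 ≤ N) (β : ℂ) (x : ℤ) (i : ℕ)
    (hx : x = (n : ℤ) + 1 - N + N * ((i : ℤ) + 1)) :
    zhat N n β x = (1 + (N : ℂ) * (i : ℂ) / ((n : ℂ) + 1)) * β ^ i := by
  have hN' : (0 : ℤ) < N := by exact_mod_cast hN
  have h1 : x - ((n : ℤ) + 1 - (N : ℤ)) = N * ((i : ℤ) + 1) := by rw [hx]; ring
  have hi : (i : ℤ) + 1 ≠ 0 := by omega
  have hi' : (1 : ℤ) ≤ (i : ℤ) + 1 := by omega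
  simp only [zhat]
  rw [h1, if_pos (dvd_mul_right _ _), Int.mul_ediv_cancel_left _ hN'.ne', if_neg hi, if_pos hi']
  simp

theorem bo_zhat_neg (N n : ℕ) (hN : 1 ≤ N) (β : ℂ) (x : ℤ) (j : ℤ) (hj : j < 0)
    (hx : x = (n : ℤ) + 1 - N + N * j) : zhat N n β x = 0 := by
  have hN' : (0 : ℤ) < N := by exact_mod_cast hN
  have h1 : x - ((n : ℤ) + 1 - (N : ℤ)) = N * j := by rw [hx]; ring
  simp only [zhat]
  rw [h1, if_pos (dvd_mul_right _ _), Int.mul_ediv_cancel_left _ hN'.ne', if_neg hj.ne,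
    if_neg (by omega)]

theorem bo_zhat_not (N n : ℕ) (β : ℂ) (x : ℤ) (hx : ¬ (N : ℤ) ∣ (x - ((n : ℤ) + 1 - (N : ℤ)))) :
    zhat N n β x = 0 := by
  simp only [zhat]
  rw [if_neg hx]

theorem bo_reduce (N n : ℕ) (hN : 1 ≤ N) (β : ℂ) (k : ℤ) (S : ℂ)
    (h : HasSum (fun j : ℕ => uhat N β (k - ((n : ℤ) + 1 - N + N * (j : ℤ))) *
      zhat N n β ((n : ℤ) + 1 - N + N * (j : ℤ))) S) :
    HasSum (fun l : ℤ => uhat N β (k - l) * zhat N n β l) S := by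
  have hN' : (0 : ℤ) < N := by exact_mod_cast hN
  have hg : Function.Injective (fun j : ℕ => (n : ℤ) + 1 - N + N * (j : ℤ)) := by
    intro a b hab
    have : (N : ℤ) * a = N * b := by simpa using hab
    exact_mod_cast mul_left_cancel₀ hN'.ne' this
  refine (hg.hasSum_iff ?_).1 h
  intro x hx
  by_cases hd : (N : ℤ) ∣ (x - ((n : ℤ) + 1 - (N : ℤ)))
  · obtain ⟨j, hj⟩ := hd
    have hx' : x = (n : ℤ) + 1 - N + N * j := by linarith
    have : j < 0 := by
      by_contra hcon
      push Not at hcon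
      apply hx
      refine ⟨j.toNat, ?_⟩
      simp only [Int.toNat_of_nonneg hcon]
      exact hx'.symm
    rw [bo_zhat_neg N n hN β x j this hx', mul_zero]
  · rw [bo_zhat_not N n β x hd, mul_zero]

theorem bo_sum_id (q : ℕ) (c : ℂ) :
    ∑ i ∈ Finset.range q, (1 + c * (i : ℂ)) = q + c * (q * (q - 1) / 2) := by
  induction q with
  | zero => simp
  | succ q ih => rw [Finset.sum_range_succ, ih]; push_cast; ring

/-- `ẑ_{N,n}` with `n ≥ N` is an eigenvector of the linearized Benjamin–Ono
operator `BA` with eigenvalue `(n+1-N)(n+1+N(1-α(β)))`. -/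
theorem benjamin_ono_eigenvector_high (N n : ℕ) (hN : 1 ≤ N) (hn : N ≤ n)
    (β : ℂ) (hβ : ‖β‖ < 1) (k : ℤ) :
    Summable (fun l : ℤ => ‖uhat N β (k - l) * zhat N n β l‖) ∧
    (k : ℂ) * (((|k| : ℤ) : ℂ) * zhat N n β k - ∑' l : ℤ, uhat N β (k - l) * zhat N n β l)
      = ((n : ℂ) + 1 - (N : ℂ)) *
          ((n : ℂ) + 1 + (N : ℂ) * (1 - (((1 - 3 * ‖β‖ ^ 2) / (1 - ‖β‖ ^ 2) : ℝ) : ℂ))) *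
          zhat N n β k := by
  suffices h : ∃ S : ℂ, HasSum (fun l : ℤ => uhat N β (k - l) * zhat N n β l) S ∧
      (k : ℂ) * (((|k| : ℤ) : ℂ) * zhat N n β k - S)
      = ((n : ℂ) + 1 - (N : ℂ)) *
          ((n : ℂ) + 1 + (N : ℂ) * (1 - (((1 - 3 * ‖β‖ ^ 2) / (1 - ‖β‖ ^ 2) : ℝ) : ℂ))) *
          zhat N n β k by
    obtain ⟨S, hS, hE⟩ := h
    exact ⟨hS.summable.norm, by rw [hS.tsum_eq]; exact hE⟩
  by_cases hd : (N : ℤ) ∣ (k - ((n : ℤ) + 1 - (N : ℤ)))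
  swap
  · refine ⟨0, ?_, by rw [bo_zhat_not N n β k hd]; ring⟩
    apply bo_reduce N n hN
    have : ∀ j : ℕ, uhat N β (k - ((n : ℤ) + 1 - N + N * (j : ℤ))) = 0 := by
      intro j
      apply bo_uhat_not
      intro hc
      apply hd
      have := dvd_add hc (dvd_mul_right (N : ℤ) (j : ℤ))
      have e : k - ((n : ℤ) + 1 - (N : ℤ)) =
          k - ((n : ℤ) + 1 - N + N * (j : ℤ)) + N * (j : ℤ) := by ring
      rw [e]
      exact this
    simp only [this, zero_mul]
    exact hasSum_zero
  obtain ⟨p, hp⟩ := hd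
  have hk : k = (n : ℤ) + 1 - N + N * p := by linarith
  -- basic quantities
  obtain ⟨r, hrdef⟩ : ∃ r : ℂ, r = ((‖β‖ : ℂ)) ^ 2 := ⟨_, rfl⟩
  have hr1 : ‖r‖ < 1 := by
    rw [hrdef, norm_pow, Complex.norm_real, norm_norm]
    exact pow_lt_one₀ (norm_nonneg _) hβ two_ne_zero
  have hr0 : (1 - r) ≠ 0 := by
    intro h0
    have : r = 1 := by linear_combination -h0
    rw [this] at hr1
    simp at hr1
  have hbb : (starRingEnd ℂ β) * β = r := by rw [hrdef, Complex.conj_mul']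
  have hm : ((n : ℂ) + 1) ≠ 0 := by exact_mod_cast Nat.succ_ne_zero n
  have hα : (((1 - 3 * ‖β‖ ^ 2) / (1 - ‖β‖ ^ 2) : ℝ) : ℂ) = (1 - 3 * r) / (1 - r) := by
    rw [hrdef]; push_cast; ring
  have hu0 := bo_uhat_zero N β
  have hz0 := bo_zhat_zero N n β _ rfl
  rw [hα] at hu0 ⊢
  rw [← hrdef] at hz0
  obtain ⟨b, hb⟩ : ∃ b : ℂ, b = starRingEnd ℂ β := ⟨_, rfl⟩
  rw [← hb] at hz0 hbb
  have hz0' : zhat N n β ((n : ℤ) + 1 - N + N * ((0 : ℕ) : ℤ)) =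
      -b / (1 - r) ^ 2 * (1 - (1 - (N : ℂ) / ((n : ℂ) + 1)) * r) := by
    rw [← hz0]; simp
  have hzs : ∀ i : ℕ, zhat N n β ((n : ℤ) + 1 - N + N * ((i + 1 : ℕ) : ℤ)) =
      (1 + (N : ℂ) / ((n : ℂ) + 1) * (i : ℂ)) * β ^ i := by
    intro i
    rw [bo_zhat_succ N n hN β _ i (by push_cast; ring)]
    ring
  have hcases : (∃ t : ℕ, p = -((t : ℤ) + 1)) ∨ p = 0 ∨ ∃ q : ℕ, p = (q : ℤ) + 1 := by
    rcases lt_trichotomy p 0 with h | h | h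
    · exact Or.inl ⟨(-p - 1).toNat, by omega⟩
    · exact Or.inr (Or.inl h)
    · exact Or.inr (Or.inr ⟨(p - 1).toNat, by omega⟩)
  rcases hcases with ⟨t, ht⟩ | h0 | ⟨q, hq⟩
  · -- negative
    have hzk : zhat N n β k = 0 := bo_zhat_neg N n hN β k p (by omega) hk
    refine ⟨0, ?_, by rw [hzk]; ring⟩
    apply bo_reduce N n hN
    rw [← hasSum_nat_add_iff' 1]
    have hg := (bo_geom r 1 ((N : ℂ) / ((n : ℂ) + 1)) hr1).mul_left (2 * (N : ℂ) * b ^ (t + 2))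
    convert! hg using 1
    · funext i
      rw [hzs, bo_uhat_neg N hN β _ (t + 1 + i) (by rw [hk, ht]; push_cast; ring), ← hb, ← hbb,
        mul_pow]
      ring
    · rw [Finset.sum_range_one, hz0', bo_uhat_neg N hN β _ t (by rw [hk, ht]; push_cast; ring),
        ← hb]
      field_simp
      ring
  · have hk' : k = (n : ℤ) + 1 - N := by rw [hk, h0]; ring
    have habs : |k| = k := abs_of_pos (by omega)
    have hkC : (k : ℂ) = (n : ℂ) + 1 - N := by rw [hk']; push_cast; ring
    have hzk : zhat N n β k = -b / (1 - r) ^ 2 * (1 - (1 - (N : ℂ) / ((n : ℂ) + 1)) * r) := by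
      rw [hk', hz0]
    refine ⟨((N : ℂ) * ((1 - 3 * r) / (1 - r)) - 2 * N) * zhat N n β k, ?_, ?_⟩
    · apply bo_reduce N n hN
      rw [← hasSum_nat_add_iff' 1]
      have hg := (bo_geom r 1 ((N : ℂ) / ((n : ℂ) + 1)) hr1).mul_left (2 * (N : ℂ) * b)
      convert! hg using 1
      · funext i
        rw [hzs, bo_uhat_neg N hN β _ i (by rw [hk']; push_cast; ring), ← hb, ← hbb, mul_pow]
        ring
      · have hx : k - ((n : ℤ) + 1 - N + N * ((0 : ℕ) : ℤ)) = 0 := by rw [hk']; simp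
        rw [Finset.sum_range_one, hz0', hx, hu0, hzk]
        field_simp
        ring
    · rw [habs, hkC]
      ring
  · have hk' : k = (n : ℤ) + 1 + N * q := by rw [hk, hq]; ring
    have habs : |k| = k := abs_of_pos (by rw [hk']; positivity)
    have hkC : (k : ℂ) = (n : ℂ) + 1 + N * q := by rw [hk']; push_cast; ring
    have hzk : zhat N n β k = (1 + (N : ℂ) / ((n : ℂ) + 1) * (q : ℂ)) * β ^ q := by
      rw [← hzs]; congr 1; rw [hk']; push_cast; ring
    have hg := (bo_geom r (1 + (N : ℂ) / ((n : ℂ) + 1) * (q + 1)) ((N : ℂ) / ((n : ℂ) + 1)) hr1).mul_left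
      (2 * (N : ℂ) * β ^ q * r)
    have hg' : HasSum (fun i : ℕ => (fun j : ℕ => uhat N β (k - ((n : ℤ) + 1 - N + N * (j : ℤ))) *
      zhat N n β ((n : ℤ) + 1 - N + N * (j : ℤ))) (i + (q + 2)))
      (2 * (N : ℂ) * β ^ q * r * ((1 + (N : ℂ) / ((n : ℂ) + 1) * (q + 1)) / (1 - r) +
        (N : ℂ) / ((n : ℂ) + 1) * (r / (1 - r) ^ 2))) := by
      convert! hg using 1
      funext i
      have e : i + (q + 2) = (i + q + 1) + 1 := by ring
      simp only [e]
      rw [hzs, bo_uhat_neg N hN β _ i (by rw [hk']; push_cast; ring), ← hb, ← hbb]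
      push_cast
      ring
    have hS := (hasSum_nat_add_iff
      (f := fun j : ℕ => uhat N β (k - ((n : ℤ) + 1 - N + N * (j : ℤ))) *
        zhat N n β ((n : ℤ) + 1 - N + N * (j : ℤ))) (q + 2)).1 hg'
    refine ⟨_, bo_reduce N n hN _ _ _ hS, ?_⟩
    have hx : k - ((n : ℤ) + 1 - N + N * ((q + 1 : ℕ) : ℤ)) = 0 := by rw [hk']; push_cast; ring
    have hmid : ∑ i ∈ Finset.range q, uhat N β (k - ((n : ℤ) + 1 - N + N * ((i + 1 : ℕ) : ℤ))) *
        zhat N n β ((n : ℤ) + 1 - N + N * ((i + 1 : ℕ) : ℤ)) =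
        2 * (N : ℂ) * β ^ q * (q + (N : ℂ) / ((n : ℂ) + 1) * (q * (q - 1) / 2)) := by
      rw [← bo_sum_id, Finset.mul_sum]
      apply Finset.sum_congr rfl
      intro i hi
      have hi' := Finset.mem_range.1 hi
      obtain ⟨s, rfl⟩ : ∃ s, q = i + s + 1 := ⟨q - i - 1, by omega⟩
      rw [hzs, bo_uhat_pos N hN β _ s (by rw [hk']; push_cast; ring)]
      ring
    rw [Finset.sum_range_succ, Finset.sum_range_succ', hmid, hx, hu0, hz0', hzs,
      bo_uhat_pos N hN β _ q (by rw [hk']; push_cast; ring), habs, hkC, hzk]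
    have hbr : β ^ (q + 1) * b = β ^ q * r := by rw [← hbb]; ring
    have e1 : 2 * (N : ℂ) * β ^ (q + 1) *
        (-b / (1 - r) ^ 2 * (1 - (1 - (N : ℂ) / ((n : ℂ) + 1)) * r)) =
        -(2 * (N : ℂ) * (β ^ q * r) / (1 - r) ^ 2 * (1 - (1 - (N : ℂ) / ((n : ℂ) + 1)) * r)) := by
      rw [← hbr]; ring
    rw [e1]
    field_simp
    ring
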